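/- Let N be a natural number, φ, θ_t ∈ ℝ with cos φ ≠ 0, and let θ : Fin N → [0, 2π) be injective. Define unit look-direction vectors a_j = (cos φ · cos θ_j, cos φ · sin θ_j, sin φ) for j ∈ Fin N and a_t = (cos φ · cos θ_t, cos φ · sin θ_t, sin φ). Fix i ∈ Fin N and points x_k, x_{k'}, x_l, x_{l'} ∈ ℝ³ of the form (u, 0) with u ∈ ℝ², such that x_l ≠ x_{l'}. Define for each j ∈ Fin N the phase term Φ_{i,j} = ⟨a_i, x_k − x_{k'}⟩ − ⟨a_j, x_l − x_{l'}⟩ + ⟨a_t, x_k − x_{k'} − x_l + x_{l'}⟩, where ⟨·,·⟩ is the standard Euclidean inner product on ℝ³. Then the set {j ∈ Fin N : Φ_{i,j} = 0} has cardinality at most 2. -/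

import Mathlib

open scoped BigOperators

/-- The standard Euclidean inner product on `ℝ³`. -/
def dot3 (a b : Fin 3 → ℝ) : ℝ := ∑ i, a i * b i

/-- Two points of the plane on the same line `p x + q y = c` and with the same coordinate
`p y - q x` along it are equal. -/
lemma eq_and_eq_of_line_coordinates {p q x y x' y' : ℝ} (hpq : p ≠ 0 ∨ q ≠ 0)
    (hline : p * x + q * y = p * x' + q * y') (halong : p * y - q * x = p * y' - q * x') :
    x = x' ∧ y = y' := by
  have hpos : p ^ 2 + q ^ 2 ≠ 0 := by
    rcases hpq with h | h <;> positivity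
  constructor <;> apply mul_left_cancel₀ hpos
  · linear_combination p * hline - q * halong
  · linear_combination q * hline + p * halong

/-- Among three points of the unit circle on a common line, two coincide. -/
lemma eq_or_eq_or_eq_of_unit_circle_of_line {p q c x₁ y₁ x₂ y₂ x₃ y₃ : ℝ}
    (hpq : p ≠ 0 ∨ q ≠ 0)
    (h₁ : x₁ ^ 2 + y₁ ^ 2 = 1) (h₂ : x₂ ^ 2 + y₂ ^ 2 = 1) (h₃ : x₃ ^ 2 + y₃ ^ 2 = 1)
    (l₁ : p * x₁ + q * y₁ = c) (l₂ : p * x₂ + q * y₂ = c) (l₃ : p * x₃ + q * y₃ = c) :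
    (x₁ = x₂ ∧ y₁ = y₂) ∨ (x₁ = x₃ ∧ y₁ = y₃) ∨ (x₂ = x₃ ∧ y₂ = y₃) := by
  have along_sq : ∀ {x y : ℝ}, x ^ 2 + y ^ 2 = 1 → p * x + q * y = c →
      (p * y - q * x) ^ 2 = p ^ 2 + q ^ 2 - c ^ 2 := by
    intro x y h l
    rw [← l]
    linear_combination (p ^ 2 + q ^ 2) * h
  have s₁ := along_sq h₁ l₁
  have s₂ := along_sq h₂ l₂
  have s₃ := along_sq h₃ l₃
  rcases sq_eq_sq_iff_eq_or_eq_neg.mp (s₁.trans s₂.symm) with e | e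
  · exact .inl (eq_and_eq_of_line_coordinates hpq (l₁.trans l₂.symm) e)
  rcases sq_eq_sq_iff_eq_or_eq_neg.mp (s₁.trans s₃.symm) with e' | e'
  · exact .inr (.inl (eq_and_eq_of_line_coordinates hpq (l₁.trans l₃.symm) e'))
  · exact .inr (.inr (eq_and_eq_of_line_coordinates hpq (l₂.trans l₃.symm)
      (neg_injective (e.symm.trans e'))))

/-- An angle in `[0, 2π)` is determined by its cosine and sine. -/
lemma eq_of_cos_eq_of_sin_eq_of_mem_Ico {a b : ℝ}
    (ha : a ∈ Set.Ico 0 (2 * Real.pi)) (hb : b ∈ Set.Ico 0 (2 * Real.pi))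
    (hcos : Real.cos a = Real.cos b) (hsin : Real.sin a = Real.sin b) : a = b := by
  have h : Real.cos (a - b) = 1 := by
    rw [Real.cos_sub, hcos, hsin]
    linear_combination Real.cos_sq_add_sin_sq b
  exact sub_eq_zero.mp ((Real.cos_eq_one_iff_of_lt_of_lt
    (by linarith [ha.1, hb.2]) (by linarith [ha.2, hb.1])).mp h)

/-- Key counting lemma in the proof of Proposition 2: with `N` receivers and a
transmitter sharing a common elevation angle `φ` (with `cos φ ≠ 0`) and
distinct azimuth angles `θ_j ∈ [0, 2π)`, for a fixed receiver index `i` and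
fixed scatterer pairs with `x_l ≠ x_{l'}`, the cross-term phase
`Φ_{i,j}^{k,k',l,l'}` vanishes for at most two receiver indices `j`. -/
theorem phase_vanishes_for_atMost_two_receivers
    (N : ℕ) (φ θt : ℝ) (hφ : Real.cos φ ≠ 0)
    (θ : Fin N → ℝ) (hθmem : ∀ j, θ j ∈ Set.Ico 0 (2 * Real.pi))
    (hθinj : Function.Injective θ)
    (i : Fin N)
    (xk xk' xl xl' : Fin 3 → ℝ)
    (hk : xk 2 = 0) (hk' : xk' 2 = 0) (hl : xl 2 = 0) (hl' : xl' 2 = 0)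
    (hll' : xl ≠ xl') :
    {j : Fin N |
      dot3 ![Real.cos φ * Real.cos (θ i), Real.cos φ * Real.sin (θ i), Real.sin φ]
          (xk - xk') -
        dot3 ![Real.cos φ * Real.cos (θ j), Real.cos φ * Real.sin (θ j), Real.sin φ]
          (xl - xl') +
        dot3 ![Real.cos φ * Real.cos θt, Real.cos φ * Real.sin θt, Real.sin φ]
          (xk - xk' - xl + xl') = 0}.encard ≤ 2 := by
  have hpq : xl 0 - xl' 0 ≠ 0 ∨ xl 1 - xl' 1 ≠ 0 := by
    by_contra! h
    apply hll'
    ext m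
    fin_cases m
    · exact sub_eq_zero.mp h.1
    · exact sub_eq_zero.mp h.2
    · exact hl.trans hl'.symm
  rw [← (Set.toFinite _).cast_ncard_eq]
  by_contra! hcard
  obtain ⟨a, b, c, ha, hb, hc, hab, hac, hbc⟩ := (Set.two_lt_ncard_iff (Set.toFinite _)).mp
    (by exact_mod_cast hcard)
  obtain ⟨C, hC⟩ : ∃ C, C =
      dot3 ![Real.cos φ * Real.cos (θ i), Real.cos φ * Real.sin (θ i), Real.sin φ]
          (xk - xk') +
        dot3 ![Real.cos φ * Real.cos θt, Real.cos φ * Real.sin θt, Real.sin φ]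
          (xk - xk' - xl + xl') := ⟨_, rfl⟩
  have line : ∀ j,
      dot3 ![Real.cos φ * Real.cos (θ i), Real.cos φ * Real.sin (θ i), Real.sin φ]
          (xk - xk') -
        dot3 ![Real.cos φ * Real.cos (θ j), Real.cos φ * Real.sin (θ j), Real.sin φ]
          (xl - xl') +
        dot3 ![Real.cos φ * Real.cos θt, Real.cos φ * Real.sin θt, Real.sin φ]
          (xk - xk' - xl + xl') = 0 →
      (xl 0 - xl' 0) * Real.cos (θ j) + (xl 1 - xl' 1) * Real.sin (θ j) =
        C / Real.cos φ := by
    intro j hj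
    have hdot :
        dot3 ![Real.cos φ * Real.cos (θ j), Real.cos φ * Real.sin (θ j), Real.sin φ]
          (xl - xl') = Real.cos φ *
            ((xl 0 - xl' 0) * Real.cos (θ j) + (xl 1 - xl' 1) * Real.sin (θ j)) := by
      simp [dot3, Fin.sum_univ_three, hl, hl']
      ring
    rw [eq_div_iff hφ]
    linear_combination -hj - hC - hdot
  have angle_inj : ∀ {j j'}, Real.cos (θ j) = Real.cos (θ j') ∧
      Real.sin (θ j) = Real.sin (θ j') → j = j' := fun h =>
    hθinj (eq_of_cos_eq_of_sin_eq_of_mem_Ico (hθmem _) (hθmem _) h.1 h.2)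
  rcases eq_or_eq_or_eq_of_unit_circle_of_line hpq (Real.cos_sq_add_sin_sq _)
    (Real.cos_sq_add_sin_sq _) (Real.cos_sq_add_sin_sq _)
    (line a ha) (line b hb) (line c hc) with h | h | h
  · exact hab (angle_inj h)
  · exact hac (angle_inj h)
  · exact hbc (angle_inj h)
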